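/- arXiv:2603.29128 — 5 statements merged into one kernel-verified Lean document; each statement's English description precedes it below -/
import Mathlib

section
/- Let Λ be a positive definite diagonal d×d real matrix, let g : ℝ^d → ℝ be μ-strongly convex with respect to ‖·‖_Λ with μ ≥ 0, let a > 0, and let F̄, u ∈ ℝ^d. Suppose u⁺ minimizes the function v ↦ a⟨F̄, v⟩ + a·g(v) + (1/2)‖v − u‖_Λ² over ℝ^d. Then for every v ∈ ℝ^d: a·(⟨F̄, u⁺ − v⟩ + g(u⁺) − g(v)) ≤ (1/2)‖v − u‖_Λ² − (1/2)‖u⁺ − u‖_Λ² − ((aμ + 1)/2)‖v − u⁺‖_Λ². -/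
open Finset

/-- Squared Mahalanobis (semi)norm `‖x‖_Λ² = ∑ i, Λ i * (x i)²` for a diagonal
matrix with diagonal entries `Λ`. -/
noncomputable def mSq {d : ℕ} (Λ : Fin d → ℝ) (x : Fin d → ℝ) : ℝ :=
  ∑ i, Λ i * x i ^ 2

/-- Standard inner product on `ℝ^d`. -/
noncomputable def dotR {d : ℕ} (x y : Fin d → ℝ) : ℝ := ∑ i, x i * y i

/-- `g` is `μ`-strongly convex with respect to the Mahalanobis norm `‖·‖_Λ`. -/
def StrongConvexW {d : ℕ} (Λ : Fin d → ℝ) (μ : ℝ) (g : (Fin d → ℝ) → ℝ) : Prop :=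
  ∀ x y : Fin d → ℝ, ∀ t : ℝ, 0 ≤ t → t ≤ 1 →
    g (t • x + (1 - t) • y) ≤ t * g x + (1 - t) * g y
      - μ / 2 * (t * (1 - t)) * mSq Λ (x - y)

theorem mSq_convex_combination_sub {d : ℕ} (Λ x y u : Fin d → ℝ) (t : ℝ) :
    mSq Λ (t • x + (1 - t) • y - u) =
      t * mSq Λ (x - u) + (1 - t) * mSq Λ (y - u) - t * (1 - t) * mSq Λ (x - y) := by
  simp only [mSq, Finset.mul_sum, ← Finset.sum_add_distrib, ← Finset.sum_sub_distrib]
  refine Finset.sum_congr rfl fun i _ => ?_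
  simp only [Pi.sub_apply, Pi.add_apply, Pi.smul_apply, smul_eq_mul]
  ring

theorem dotR_convex_combination {d : ℕ} (z x y : Fin d → ℝ) (t : ℝ) :
    dotR z (t • x + (1 - t) • y) = t * dotR z x + (1 - t) * dotR z y := by
  simp only [dotR, Finset.mul_sum, ← Finset.sum_add_distrib]
  refine Finset.sum_congr rfl fun i _ => ?_
  simp only [Pi.add_apply, Pi.smul_apply, smul_eq_mul]
  ring

theorem dotR_sub {d : ℕ} (z x y : Fin d → ℝ) : dotR z (x - y) = dotR z x - dotR z y := by
  simp only [dotR, ← Finset.sum_sub_distrib, Pi.sub_apply, mul_sub]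

theorem le_of_forall_le_add_mul {x y c : ℝ} (h : ∀ t : ℝ, 0 < t → t ≤ 1 → x ≤ y + t * c) :
    x ≤ y := by
  have hlim : Filter.Tendsto (fun t : ℝ => y + t * c) (nhdsWithin 0 (Set.Ioi 0)) (nhds y) := by
    have hc : Continuous fun t : ℝ => y + t * c := by fun_prop
    simpa using (hc.tendsto 0).mono_left nhdsWithin_le_nhds
  refine ge_of_tendsto hlim ?_
  filter_upwards [Ioc_mem_nhdsGT (zero_lt_one' ℝ)] with t ht
  exact h t ht.1 ht.2


theorem stmt1 {d : ℕ} (Λ : Fin d → ℝ) (hΛ : ∀ i, 0 < Λ i)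
    (μ : ℝ) (hμ : 0 ≤ μ) (g : (Fin d → ℝ) → ℝ) (hg : StrongConvexW Λ μ g)
    (a : ℝ) (ha : 0 < a) (Fb u uplus : Fin d → ℝ)
    (hmin : ∀ v : Fin d → ℝ,
      a * dotR Fb uplus + a * g uplus + 1 / 2 * mSq Λ (uplus - u)
        ≤ a * dotR Fb v + a * g v + 1 / 2 * mSq Λ (v - u)) :
    ∀ v : Fin d → ℝ,
      a * (dotR Fb (uplus - v) + g uplus - g v)
        ≤ 1 / 2 * mSq Λ (v - u) - 1 / 2 * mSq Λ (uplus - u)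
          - (a * μ + 1) / 2 * mSq Λ (v - uplus) := by
  intro v
  refine le_of_forall_le_add_mul (c := (a * μ + 1) / 2 * mSq Λ (v - uplus)) fun t ht ht1 => ?_
  have hw := hmin (t • v + (1 - t) • uplus)
  have hgw := mul_le_mul_of_nonneg_left (hg v uplus t ht.le ht1) ha.le
  rw [mSq_convex_combination_sub, dotR_convex_combination] at hw
  rw [dotR_sub]
  refine le_of_mul_le_mul_left ?_ ht
  linarith
end

section
/- Let β ∈ ((√5 − 1)/2, 1), γ ∈ (0, 1 − 1/(β(1+β))), ρ ∈ (1, 1/β), μ ≥ 0, and set η := √(γ(1+β)/(1+β²)), ρ₀ := min{ρ, β(1+β)(1−γ)}, and τ := 3ρ₀²(1+ρβ)/(2(ρβ)² + 3ρ₀²(1+ρβ)). Let (a_k)_{k ≥ −1} be positive reals with a_{−1} = a_0, let (L_k)_{k ≥ 1} and (L̂_k)_{k ≥ 1} be positive reals, and define ω_k := (1 + ρβμa_k)/(1 + μa_k) for k ≥ 0 and φ_k := √(a_k(βμa_{k−1} + 1)/(β a_{k−1})) for k ≥ 0. Then τ ∈ (0,1); and if for every k ≥ 1 either (known-μ form)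 a_k ≤ min{ρ₀ a_{k−1}, (η/2)·min{√τ·ω_{k−1}/(√3·L_k·√(1+ω_{k−1})), √((1−τ)ω_{k−1})/(√2·L̂_k)}·φ_{k−1}} holds for all k ≥ 1, or (unknown-μ form) a_k ≤ min{ρ₀ a_{k−1}, (η/(2√β))·min{√τ·ρβ/(√3·L_k·√(1+ρβ)), √((1−τ)ρβ)/(√2·L̂_k)}·√(a_{k−1}/a_{k−2})} holds for all k ≥ 1, then the complete step size conditions hold: for all k ≥ 1, a_k ≤ ρ·a_{k−1}, a_k·max{1 − (1−γ)β²μ a_{k−1}, 0} ≤ β(1+β)(1−γ)·a_{k−1}, a_k ≤ (η/2)·(√τ·ω_{k−1}/(√3·L_k·√(1+ω_{k−1})))·φ_{k−1}, and a_k ≤ (η/2)·(√((1−τ)ω_{k−1}/2)/L̂_k)·φ_{k−1}; for all k ≥ 2, a_k ≤ (η√τ/(2√3))·(ω_{k−1}·√(ω_{k−2})/(L̂_{k−1}·√(1+ω_{k−1})))·φ_{k−2}; and for all k ≥ 3, a_k ≤ (η√τ/(2√3))·(ω_{k−1}/(L̂_{k−2}·√(1+ω_{k−1})))·√(ω_{k−3}/ω_{k−2})·(a_{k−1}/a_{k−2})·φ_{k−3}.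 -/
theorem div_sqrt_one_add_le_div_sqrt_one_add {p w : ℝ} (hp : 0 < p) (hpw : p ≤ w) :
    p / √(1 + p) ≤ w / √(1 + w) := by
  have hw : 0 < w := hp.trans_le hpw
  rw [div_le_div_iff₀ (by positivity) (by positivity)]
  refine (sq_le_sq₀ (by positivity) (by positivity)).1 ?_
  rw [mul_pow, mul_pow, Real.sq_sqrt (by positivity), Real.sq_sqrt (by positivity)]
  nlinarith [mul_le_mul_of_nonneg_left hpw (mul_pos hp hw).le, mul_self_le_mul_self hp.le hpw]

/-- The weight `t` balances the two step size bounds. -/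
theorem mul_sqrt_one_sub_div_sqrt_two_eq {p r t : ℝ} (hp : 0 < p) (hr : 0 < r)
    (ht : t = 3 * r ^ 2 * (1 + p) / (2 * p ^ 2 + 3 * r ^ 2 * (1 + p)))
    (ht0 : 0 < t) (ht1 : t < 1) :
    r * (√(1 - t) / √2) = √t / √3 * (p / √(1 + p)) := by
  have h1 : 0 < 1 - t := sub_pos.2 ht1
  rw [← sq_eq_sq₀ (by positivity) (by positivity)]
  simp only [mul_pow, div_pow]
  rw [Real.sq_sqrt h1.le, Real.sq_sqrt ht0.le, Real.sq_sqrt (by positivity),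
    Real.sq_sqrt (by positivity), Real.sq_sqrt (by positivity), ht]
  field_simp
  ring

theorem attenuation_mem_Icc {p m x : ℝ} (hp : p ≤ 1) (hm : 0 ≤ m) (hx : 0 < x) :
    p ≤ (1 + p * m * x) / (1 + m * x) ∧ (1 + p * m * x) / (1 + m * x) ≤ 1 := by
  have h : 0 ≤ m * x := by positivity
  rw [le_div_iff₀ (by positivity), div_le_one (by positivity)]
  constructor <;> nlinarith


theorem stmt3 (β γ ρ μ : ℝ)
    (hβ0 : (Real.sqrt 5 - 1) / 2 < β) (hβ1 : β < 1)
    (hγ0 : 0 < γ) (hγ1 : γ < 1 - 1 / (β * (1 + β)))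
    (hρ1 : 1 < ρ) (hρ2 : ρ < 1 / β) (hμ : 0 ≤ μ)
    (a L Lh ω φ : ℤ → ℝ)
    (ham : a (-1) = a 0)
    (hapos : ∀ k : ℤ, -1 ≤ k → 0 < a k)
    (hL : ∀ k : ℤ, 1 ≤ k → 0 < L k) (hLh : ∀ k : ℤ, 1 ≤ k → 0 < Lh k)
    (hω : ∀ k : ℤ, 0 ≤ k → ω k = (1 + ρ * β * μ * a k) / (1 + μ * a k))
    (hφ : ∀ k : ℤ, 0 ≤ k →
      φ k = Real.sqrt (a k * (β * μ * a (k - 1) + 1) / (β * a (k - 1)))) :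
    let η := Real.sqrt (γ * (1 + β) / (1 + β ^ 2))
    let ρ₀ := min ρ (β * (1 + β) * (1 - γ))
    let τ := 3 * ρ₀ ^ 2 * (1 + ρ * β) /
      (2 * (ρ * β) ^ 2 + 3 * ρ₀ ^ 2 * (1 + ρ * β))
    (0 < τ ∧ τ < 1) ∧
    (((∀ k : ℤ, 1 ≤ k →
        -- known-μ simplified step size condition
        a k ≤ min (ρ₀ * a (k - 1))
          (η / 2 *
            min (Real.sqrt τ * ω (k - 1) /
                  (Real.sqrt 3 * L k * Real.sqrt (1 + ω (k - 1))))
                (Real.sqrt ((1 - τ) * ω (k - 1)) / (Real.sqrt 2 * Lh k)) *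
            φ (k - 1))) ∨
      (∀ k : ℤ, 1 ≤ k →
        -- unknown-μ simplified step size condition
        a k ≤ min (ρ₀ * a (k - 1))
          (η / (2 * Real.sqrt β) *
            min (Real.sqrt τ * (ρ * β) /
                  (Real.sqrt 3 * L k * Real.sqrt (1 + ρ * β)))
                (Real.sqrt ((1 - τ) * (ρ * β)) / (Real.sqrt 2 * Lh k)) *
            Real.sqrt (a (k - 1) / a (k - 2))))) →
      ((∀ k : ℤ, 1 ≤ k →
          a k ≤ ρ * a (k - 1) ∧
          a k * max (1 - (1 - γ) * β ^ 2 * μ * a (k - 1)) 0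
            ≤ β * (1 + β) * (1 - γ) * a (k - 1) ∧
          a k ≤ η / 2 *
            (Real.sqrt τ * ω (k - 1) /
              (Real.sqrt 3 * L k * Real.sqrt (1 + ω (k - 1)))) * φ (k - 1) ∧
          a k ≤ η / 2 *
            (Real.sqrt ((1 - τ) * ω (k - 1) / 2) / Lh k) * φ (k - 1)) ∧
        (∀ k : ℤ, 2 ≤ k →
          a k ≤ η * Real.sqrt τ / (2 * Real.sqrt 3) *
            (ω (k - 1) * Real.sqrt (ω (k - 2)) /
              (Lh (k - 1) * Real.sqrt (1 + ω (k - 1)))) * φ (k - 2)) ∧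
        (∀ k : ℤ, 3 ≤ k →
          a k ≤ η * Real.sqrt τ / (2 * Real.sqrt 3) *
            (ω (k - 1) / (Lh (k - 2) * Real.sqrt (1 + ω (k - 1)))) *
            Real.sqrt (ω (k - 3) / ω (k - 2)) *
            (a (k - 1) / a (k - 2)) * φ (k - 3)))) := by
  intro η ρ₀ τ
  have hβ : 0 < β := by
    have : (1 : ℝ) < √5 := by
      rw [Real.lt_sqrt] <;> norm_num
    linarith
  have hρ : 0 < ρ := one_pos.trans hρ1
  have hp : 0 < ρ * β := by positivity
  have hp1 : ρ * β < 1 := (lt_div_iff₀ hβ).1 hρ2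
  have hγ : 0 < 1 - γ := by
    have : 0 < 1 / (β * (1 + β)) := by positivity
    linarith
  have hρ₀ : 0 < ρ₀ := lt_min hρ (by positivity)
  have hτ0 : 0 < τ := by positivity
  have hτ1 : τ < 1 := by
    rw [div_lt_one (by positivity)]
    have : 0 < 2 * (ρ * β) ^ 2 := by positivity
    linarith
  have hη : 0 ≤ η := Real.sqrt_nonneg _
  have hbal : ρ₀ * (√(1 - τ) / √2) = √τ / √3 * (ρ * β / √(1 + ρ * β)) :=
    mul_sqrt_one_sub_div_sqrt_two_eq hp hρ₀ rfl hτ0 hτ1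
  clear_value η τ
  have hωb : ∀ k : ℤ, 0 ≤ k → ρ * β ≤ ω k ∧ ω k ≤ 1 := fun k hk ↦ by
    rw [hω k hk]
    exact attenuation_mem_Icc hp1.le hμ (hapos k (by lia))
  have hφ0 : ∀ k : ℤ, 0 ≤ k → 0 ≤ φ k := fun k hk ↦ by
    rw [hφ k hk]
    exact Real.sqrt_nonneg _
  have h1τ : 0 ≤ 1 - τ := sub_nonneg.2 hτ1.le
  refine ⟨⟨hτ0, hτ1⟩, fun h ↦ ?_⟩
  have hknown : ∀ k : ℤ, 1 ≤ k → a k ≤ ρ₀ * a (k - 1) ∧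
      a k ≤ η / 2 * (√τ * ω (k - 1) / (√3 * L k * √(1 + ω (k - 1)))) * φ (k - 1) ∧
      a k ≤ η / 2 * (√((1 - τ) * ω (k - 1)) / (√2 * Lh k)) * φ (k - 1) := by
    intro k hk
    have hLk := hL k hk
    have hLhk := hLh k hk
    have hφk := hφ0 (k - 1) (by lia)
    obtain ⟨hω1, -⟩ := hωb (k - 1) (by lia)
    rcases h with h | h
    · obtain ⟨h1, h2⟩ := le_min_iff.1 (h k hk)
      refine ⟨h1, h2.trans ?_, h2.trans ?_⟩ <;> gcongr
      exacts [min_le_left _ _, min_le_right _ _]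
    · obtain ⟨h1, h2⟩ := le_min_iff.1 (h k hk)
      have ha1 := hapos (k - 1) (by lia)
      have ha2 := hapos (k - 2) (by lia)
      have hratio : √(a (k - 1) / a (k - 2)) / √β ≤ φ (k - 1) := by
        rw [hφ _ (by lia), show k - 1 - 1 = k - 2 by ring, ← Real.sqrt_div (by positivity)]
        apply Real.sqrt_le_sqrt
        rw [div_div, mul_comm (a (k - 2))]
        gcongr
        have : 0 ≤ β * μ * a (k - 2) := by positivity
        nlinarith
      have hbound : ∀ x y : ℝ, 0 ≤ y → x ≤ y →
          η / (2 * √β) * x * √(a (k - 1) / a (k - 2)) ≤ η / 2 * y * φ (k - 1) := by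
        intro x y hy hxy
        calc η / (2 * √β) * x * √(a (k - 1) / a (k - 2))
            = η / 2 * x * (√(a (k - 1) / a (k - 2)) / √β) := by field_simp
          _ ≤ η / 2 * y * φ (k - 1) := by gcongr
      have hω0 : 0 < ω (k - 1) := hp.trans_le hω1
      refine ⟨h1, h2.trans (hbound _ _ (by positivity) ((min_le_left _ _).trans ?_)),
        h2.trans (hbound _ _ (by positivity) ((min_le_right _ _).trans ?_))⟩
      · calc √τ * (ρ * β) / (√3 * L k * √(1 + ρ * β))
            = √τ / (√3 * L k) * (ρ * β / √(1 + ρ * β)) := by field_simp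
          _ ≤ √τ / (√3 * L k) * (ω (k - 1) / √(1 + ω (k - 1))) := by
            gcongr ?_ * ?_
            exact div_sqrt_one_add_le_div_sqrt_one_add hp hω1
          _ = _ := by field_simp
      · gcongr
  clear h
  have hbal_le : ∀ k : ℤ, 0 ≤ k →
      ρ₀ * (√(1 - τ) / √2) ≤ √τ / √3 * (ω k / √(1 + ω k)) := fun k hk ↦ by
    rw [hbal]
    gcongr ?_ * ?_
    exact div_sqrt_one_add_le_div_sqrt_one_add hp (hωb k hk).1
  refine ⟨fun k hk ↦ ?_, fun k hk ↦ ?_, fun k hk ↦ ?_⟩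
  · obtain ⟨h1, h2, h3⟩ := hknown k hk
    have ha0 := hapos k (by lia)
    have ha1 := hapos (k - 1) (by lia)
    refine ⟨h1.trans ?_, ?_, h2, h3.trans_eq ?_⟩
    · gcongr
      exact min_le_left _ _
    · have hmax : max (1 - (1 - γ) * β ^ 2 * μ * a (k - 1)) 0 ≤ 1 := by
        refine max_le (sub_le_self _ ?_) zero_le_one
        positivity
      calc a k * max (1 - (1 - γ) * β ^ 2 * μ * a (k - 1)) 0
          ≤ a k := mul_le_of_le_one_right ha0.le hmax
        _ ≤ ρ₀ * a (k - 1) := h1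
        _ ≤ β * (1 + β) * (1 - γ) * a (k - 1) := by
          gcongr
          exact min_le_right _ _
    · have := (hωb (k - 1) (by lia)).1
      rw [Real.sqrt_div (mul_nonneg h1τ (hp.le.trans this)), div_div]
  · have h1 := (hknown k (by lia)).1
    have h3 := (hknown (k - 1) (by lia)).2.2
    rw [show k - 1 - 1 = k - 2 by ring, Real.sqrt_mul h1τ] at h3
    have hLk := hLh (k - 1) (by lia)
    have hφk := hφ0 (k - 2) (by lia)
    calc a k ≤ ρ₀ * a (k - 1) := h1
      _ ≤ ρ₀ * (η / 2 * (√(1 - τ) * √(ω (k - 2)) / (√2 * Lh (k - 1))) * φ (k - 2)) := by gcongr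
      _ = ρ₀ * (√(1 - τ) / √2) * (η / 2 * (√(ω (k - 2)) / Lh (k - 1)) * φ (k - 2)) := by
        field_simp
      _ ≤ √τ / √3 * (ω (k - 1) / √(1 + ω (k - 1))) *
          (η / 2 * (√(ω (k - 2)) / Lh (k - 1)) * φ (k - 2)) := by
        gcongr ?_ * _
        exact hbal_le _ (by lia)
      _ = _ := by
        have := hp.trans_le (hωb (k - 1) (by lia)).1
        field_simp
  · have h1 := (hknown k (by lia)).1
    have h3 := (hknown (k - 2) (by lia)).2.2
    rw [show k - 2 - 1 = k - 3 by ring, Real.sqrt_mul h1τ] at h3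
    have hLk := hLh (k - 2) (by lia)
    have hφk := hφ0 (k - 3) (by lia)
    have ha1 := hapos (k - 1) (by lia)
    have ha2 := hapos (k - 2) (by lia)
    have hω1 := hp.trans_le (hωb (k - 1) (by lia)).1
    have hω3 := hp.trans_le (hωb (k - 3) (by lia)).1
    obtain ⟨hω2, hω2'⟩ := hωb (k - 2) (by lia)
    replace hω2 := hp.trans_le hω2
    calc a k ≤ ρ₀ * a (k - 1) := h1
      _ = ρ₀ * (a (k - 1) / a (k - 2) * a (k - 2)) := by field_simp
      _ ≤ ρ₀ * (a (k - 1) / a (k - 2) *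
          (η / 2 * (√(1 - τ) * √(ω (k - 3)) / (√2 * Lh (k - 2))) * φ (k - 3))) := by gcongr
      _ = ρ₀ * (√(1 - τ) / √2) * √(ω (k - 3)) *
          (a (k - 1) / a (k - 2) * (η / 2 / Lh (k - 2)) * φ (k - 3)) := by
        field_simp
      _ ≤ √τ / √3 * (ω (k - 1) / √(1 + ω (k - 1))) * √(ω (k - 3) / ω (k - 2)) *
          (a (k - 1) / a (k - 2) * (η / 2 / Lh (k - 2)) * φ (k - 3)) := by
        gcongr ?_ * √?_ * _
        · exact hbal_le _ (by lia)
        · exact le_div_self hω3.le hω2 hω2'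
      _ = _ := by ring
end

section
/- Let Λ be a positive definite diagonal d×d real matrix, let g : ℝ^d → ℝ be μ-strongly convex with respect to ‖·‖_Λ with μ ≥ 0, let β ∈ (0,1), γ ∈ (0,1), ω_{k−1} > 0, and let a_{k−1}, a_k > 0 satisfy a_k ≤ (1−γ)·β·(1 + β + βμa_k)·a_{k−1}. Let F̄_{k−1}, F̄_k, v_{k−1}, u_k ∈ ℝ^d, define v_k := (1−β)u_k + β v_{k−1}, suppose u_k minimizes v ↦ a_{k−1}⟨F̄_{k−1}, v⟩ + a_{k−1}g(v) + (1/2)‖v − v_{k−1}‖_Λ² over ℝ^d, suppose u_{k+1} minimizes v ↦ a_k⟨F̄_k, v⟩ + a_k g(v) + (1/2)‖v − v_k‖_Λ² over ℝ^d, and define v_{k+1} := (1−β)u_{k+1} + β v_k. Then for every u ∈ ℝ^d, the quantity h_k^{(2)}(u) := a_k·(⟨F̄_k, u_k − u⟩ + g(u_k) − g(u)) satisfies: h_k^{(2)}(u) ≤ (1/(2(1−β)))·((1 + βμa_k)‖u − v_k‖_Λ² − (1 + μa_k)‖u − v_{k+1}‖_Λ²) + (γβ²(1+β)/(2(1+β²)))·(ω_{k−1}‖u_k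 − v_{k−1}‖_Λ² − ‖u_{k+1} − v_k‖_Λ²) + a_k⟨F̄_k − F̄_{k−1}, u_k − u_{k+1}⟩ − (γω_{k−1}(1+β)/(2(1+ω_{k−1})(1+β²)) + a_k(1 + βμa_{k−1})/(2β a_{k−1}))·‖u_{k+1} − u_k‖_Λ². -/
open Finset

lemma mSq_nonneg {d : ℕ} {Λ : Fin d → ℝ} (hΛ : ∀ i, 0 ≤ Λ i) (x : Fin d → ℝ) : 0 ≤ mSq Λ x :=
  Finset.sum_nonneg fun i _ => mul_nonneg (hΛ i) (sq_nonneg _)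

lemma mSq_smul {d : ℕ} (Λ : Fin d → ℝ) (c : ℝ) (x : Fin d → ℝ) :
    mSq Λ (c • x) = c ^ 2 * mSq Λ x := by
  simp only [mSq, Finset.mul_sum, Pi.smul_apply, smul_eq_mul]
  exact Finset.sum_congr rfl fun i _ => by ring

lemma mSq_sub_comm {d : ℕ} (Λ x y : Fin d → ℝ) : mSq Λ (x - y) = mSq Λ (y - x) := by
  simp only [mSq, Pi.sub_apply]
  exact Finset.sum_congr rfl fun i _ => by ring

lemma mSq_convex_comb_sub {d : ℕ} (Λ x y z : Fin d → ℝ) (t : ℝ) :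
    mSq Λ (t • x + (1 - t) • y - z)
      = t * mSq Λ (x - z) + (1 - t) * mSq Λ (y - z) - t * (1 - t) * mSq Λ (x - y) := by
  simp only [mSq, Finset.mul_sum, ← Finset.sum_add_distrib, ← Finset.sum_sub_distrib,
    Pi.smul_apply, smul_eq_mul, Pi.sub_apply, Pi.add_apply]
  exact Finset.sum_congr rfl fun i _ => by ring

/-- Young's inequality for the Mahalanobis norm. -/
lemma mul_mSq_sub_le {d : ℕ} {Λ : Fin d → ℝ} (hΛ : ∀ i, 0 ≤ Λ i) (ω : ℝ) (x y : Fin d → ℝ) :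
    ω * mSq Λ (x - y) ≤ (1 + ω) * (mSq Λ x + ω * mSq Λ y) := by
  simp only [mSq, Finset.mul_sum, ← Finset.sum_add_distrib, Pi.sub_apply]
  refine Finset.sum_le_sum fun i _ => ?_
  linarith [mul_nonneg (hΛ i) (sq_nonneg (x i + ω * y i))]

lemma dotR_add_right {d : ℕ} (x y z : Fin d → ℝ) : dotR x (y + z) = dotR x y + dotR x z :=
  dotProduct_add x y z

lemma dotR_sub_right {d : ℕ} (x y z : Fin d → ℝ) : dotR x (y - z) = dotR x y - dotR x z :=
  dotProduct_sub x y z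

lemma dotR_sub_left {d : ℕ} (x y z : Fin d → ℝ) : dotR (x - y) z = dotR x z - dotR y z :=
  sub_dotProduct x y z

lemma dotR_smul_right {d : ℕ} (c : ℝ) (x y : Fin d → ℝ) : dotR x (c • y) = c * dotR x y :=
  dotProduct_smul c x y

lemma nonpos_of_forall_le_mul {A B : ℝ} (h : ∀ t : ℝ, 0 < t → t ≤ 1 → A ≤ t * B) : A ≤ 0 := by
  have hlim : Filter.Tendsto (fun t : ℝ => t * B) (nhdsWithin 0 (Set.Ioi 0)) (nhds 0) := by
    have hc : Continuous fun t : ℝ => t * B := by fun_prop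
    simpa using (hc.tendsto 0).mono_left nhdsWithin_le_nhds
  refine ge_of_tendsto hlim ?_
  filter_upwards [Ioc_mem_nhdsGT (zero_lt_one' ℝ)] with t ht
  exact h t ht.1 ht.2

/-- The three-point inequality satisfied by the minimizer `p` of a proximal step with step size `a`
and prox-center `v`. -/
lemma StrongConvexW.prox_three_point {d : ℕ} {Λ : Fin d → ℝ} {μ : ℝ} {g : (Fin d → ℝ) → ℝ}
    (hg : StrongConvexW Λ μ g) {a : ℝ} (ha : 0 ≤ a) {F v p : Fin d → ℝ}
    (hmin : ∀ w : Fin d → ℝ, a * dotR F p + a * g p + 1 / 2 * mSq Λ (p - v)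
      ≤ a * dotR F w + a * g w + 1 / 2 * mSq Λ (w - v)) (w : Fin d → ℝ) :
    a * dotR F p + a * g p + 1 / 2 * mSq Λ (p - v) + (1 + μ * a) / 2 * mSq Λ (w - p)
      ≤ a * dotR F w + a * g w + 1 / 2 * mSq Λ (w - v) := by
  suffices h : a * dotR F p + a * g p + 1 / 2 * mSq Λ (p - v) + (1 + μ * a) / 2 * mSq Λ (w - p)
      - (a * dotR F w + a * g w + 1 / 2 * mSq Λ (w - v)) ≤ 0 by linarith
  refine nonpos_of_forall_le_mul (B := (1 + μ * a) / 2 * mSq Λ (w - p)) fun t ht0 ht1 => ?_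
  have hm := hmin (t • w + (1 - t) • p)
  have hc := mul_le_mul_of_nonneg_left (hg w p t ht0.le ht1) ha
  rw [mSq_convex_comb_sub, dotR_add_right, dotR_smul_right, dotR_smul_right] at hm
  refine le_of_mul_le_mul_left ?_ ht0
  linarith

theorem stmt5 {d : ℕ} (Λ : Fin d → ℝ) (hΛ : ∀ i, 0 < Λ i)
    (μ : ℝ) (hμ : 0 ≤ μ) (g : (Fin d → ℝ) → ℝ) (hg : StrongConvexW Λ μ g)
    (β γ ωkm1 akm1 ak : ℝ)
    (hβ0 : 0 < β) (hβ1 : β < 1) (hγ0 : 0 < γ) (hγ1 : γ < 1)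
    (hωkm1 : 0 < ωkm1) (hakm1 : 0 < akm1) (hak : 0 < ak)
    (hstep : ak ≤ (1 - γ) * β * (1 + β + β * μ * ak) * akm1)
    (Fbkm1 Fbk vkm1 uk ukp1 : Fin d → ℝ)
    (hmink : ∀ w : Fin d → ℝ,
      akm1 * dotR Fbkm1 uk + akm1 * g uk + 1 / 2 * mSq Λ (uk - vkm1)
        ≤ akm1 * dotR Fbkm1 w + akm1 * g w + 1 / 2 * mSq Λ (w - vkm1))
    (hminkp1 : ∀ w : Fin d → ℝ,
      ak * dotR Fbk ukp1 + ak * g ukp1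
          + 1 / 2 * mSq Λ (ukp1 - ((1 - β) • uk + β • vkm1))
        ≤ ak * dotR Fbk w + ak * g w
          + 1 / 2 * mSq Λ (w - ((1 - β) • uk + β • vkm1))) :
    let vk : Fin d → ℝ := (1 - β) • uk + β • vkm1
    let vkp1 : Fin d → ℝ := (1 - β) • ukp1 + β • vk
    ∀ u : Fin d → ℝ,
      ak * (dotR Fbk (uk - u) + g uk - g u)
        ≤ 1 / (2 * (1 - β)) *
            ((1 + β * μ * ak) * mSq Λ (u - vk) - (1 + μ * ak) * mSq Λ (u - vkp1))
          + γ * β ^ 2 * (1 + β) / (2 * (1 + β ^ 2)) *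
              (ωkm1 * mSq Λ (uk - vkm1) - mSq Λ (ukp1 - vk))
          + ak * dotR (Fbk - Fbkm1) (uk - ukp1)
          - (γ * ωkm1 * (1 + β) / (2 * (1 + ωkm1) * (1 + β ^ 2))
              + ak * (1 + β * μ * akm1) / (2 * β * akm1)) * mSq Λ (ukp1 - uk) := by
  intro vk vkp1 u
  have hr := StrongConvexW.prox_three_point hg hakm1.le hmink ukp1
  have hp : ak * dotR Fbk ukp1 + ak * g ukp1 + 1 / 2 * mSq Λ (ukp1 - vk)
      + (1 + μ * ak) / 2 * mSq Λ (u - ukp1)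
      ≤ ak * dotR Fbk u + ak * g u + 1 / 2 * mSq Λ (u - vk) :=
    StrongConvexW.prox_three_point hg hak.le hminkp1 u
  have hvk : mSq Λ (ukp1 - vk) = (1 - β) * mSq Λ (ukp1 - uk) + β * mSq Λ (ukp1 - vkm1)
      - β * (1 - β) * mSq Λ (uk - vkm1) := by
    have h := mSq_convex_comb_sub Λ uk vkm1 ukp1 (1 - β)
    rw [sub_sub_cancel, mSq_sub_comm Λ _ ukp1, mSq_sub_comm Λ _ ukp1, mSq_sub_comm Λ _ ukp1] at h
    linarith
  have hvkp1 : mSq Λ (u - vkp1) = (1 - β) * mSq Λ (u - ukp1) + β * mSq Λ (u - vk)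
      - β * (1 - β) * mSq Λ (ukp1 - vk) := by
    have h := mSq_convex_comb_sub Λ ukp1 vk u (1 - β)
    rw [sub_sub_cancel, mSq_sub_comm Λ _ u, mSq_sub_comm Λ _ u, mSq_sub_comm Λ _ u] at h
    linarith
  have hyoung : ωkm1 * mSq Λ (ukp1 - uk)
      ≤ (1 + ωkm1) * (mSq Λ (ukp1 - vk) + ωkm1 * (β ^ 2 * mSq Λ (uk - vkm1))) := by
    have h := mul_mSq_sub_le (fun i => (hΛ i).le) ωkm1 (ukp1 - vk) (β • (uk - vkm1))
    have he : ukp1 - vk - β • (uk - vkm1) = ukp1 - uk := by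
      simp only [vk]; module
    rwa [mSq_smul, he] at h
  have hP0 := mSq_nonneg (fun i => (hΛ i).le) (ukp1 - vk)
  have hE0 := mSq_nonneg (fun i => (hΛ i).le) (uk - vkm1)
  simp only [dotR_sub_right, dotR_sub_left]
  rw [hvkp1]
  generalize mSq Λ (ukp1 - vk) = P at *
  generalize mSq Λ (uk - vkm1) = E at *
  generalize mSq Λ (ukp1 - uk) = D at *
  generalize mSq Λ (ukp1 - vkm1) = Q at *
  generalize mSq Λ (u - vk) = U at *
  generalize mSq Λ (u - ukp1) = V at *
  have hβ' : 1 - β ≠ 0 := by linarith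
  obtain ⟨r, rfl⟩ : ∃ r, ak = r * akm1 := ⟨ak / akm1, by field_simp⟩
  have hr0 : 0 < r := pos_of_mul_pos_left hak hakm1.le
  set M := 1 + β + β * μ * (r * akm1) with hM
  have hrle : r ≤ (1 - γ) * β * M := le_of_mul_le_mul_right hstep hakm1
  have hMle : 1 + β ≤ M := by
    have : 0 ≤ β * μ * (r * akm1) := by positivity
    linarith
  set κ := γ * (1 + β) / (2 * (1 + β ^ 2)) with hκ
  have hκ0 : 0 ≤ κ := by positivity
  have hκ' : κ * (1 + β ^ 2) = γ * (1 + β) / 2 := by rw [hκ]; field_simp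
  have e1 : γ * β ^ 2 * (1 + β) / (2 * (1 + β ^ 2)) = κ * β ^ 2 := by rw [hκ]; field_simp
  have e2 : γ * ωkm1 * (1 + β) / (2 * (1 + ωkm1) * (1 + β ^ 2)) * D
      = κ * (ωkm1 * D / (1 + ωkm1)) := by
    rw [hκ]; field_simp
  have e3 : r * akm1 * (1 + β * μ * akm1) / (2 * β * akm1)
      = r * (1 + β * μ * akm1) / (2 * β) := by field_simp
  have e4 : 1 / (2 * (1 - β)) * ((1 + β * μ * (r * akm1)) * U
      - (1 + μ * (r * akm1)) * ((1 - β) * V + β * U - β * (1 - β) * P))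
      = U / 2 - (1 + μ * (r * akm1)) / 2 * V + (1 + μ * (r * akm1)) * β / 2 * P := by
    field_simp; ring
  have hQ : r / 2 * Q = r / (2 * β) * (P - (1 - β) * D + β * (1 - β) * E) := by
    rw [hvk]; field_simp; ring
  have e5 : r * (1 + β * μ * akm1) / (2 * β) * D = r / (2 * β) * D + r * μ * akm1 / 2 * D := by
    field_simp
  have e6 : r / (2 * β) * (P - (1 - β) * D + β * (1 - β) * E)
      = r / (2 * β) * P - r / (2 * β) * D + r / 2 * D + r / 2 * E - r * β / 2 * E := by
    field_simp; ring
  have hy : κ * (ωkm1 * D / (1 + ωkm1)) ≤ κ * (P + ωkm1 * (β ^ 2 * E)) := by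
    refine mul_le_mul_of_nonneg_left ?_ hκ0
    rw [div_le_iff₀ (by linarith)]
    linarith
  have hrP : r / (2 * β) * P ≤ (1 - γ) * M / 2 * P := by
    refine mul_le_mul_of_nonneg_right ?_ hP0
    rw [div_le_iff₀ (by linarith)]
    linarith
  have hMP : κ * (1 + β ^ 2) * P ≤ γ * M / 2 * P := by
    rw [hκ']
    refine mul_le_mul_of_nonneg_right ?_ hP0
    linarith [mul_le_mul_of_nonneg_left hMle hγ0.le]
  have hrE : 0 ≤ r * β / 2 * E := by positivity
  have hr' := mul_le_mul_of_nonneg_left hr hr0.le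
  rw [e1, e3, e4, add_mul _ _ D, e2, e5]
  rw [hM] at hrP hMP
  linarith
end

section
/- Let s_∞ > 0, ρ₀ ∈ (1, 2), let t ≥ 1 be an integer, and let a_{k−2}, a_{k−1}, a_k, s_k be positive reals with s_k ≥ s_∞, a_{k−1} ≥ s_∞/2, a_k = s_k·√(a_{k−1}/a_{k−2}), and ρ₀^{t−1}·a_k < s_∞/2. Then a_{k−2} ≥ (s_∞/2)·ρ₀^{2t}. -/
theorem stmt11 (sinf ρ₀ : ℝ) (hsinf : 0 < sinf) (hρ₀1 : 1 < ρ₀) (hρ₀2 : ρ₀ < 2)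
    (t : ℕ) (ht : 1 ≤ t)
    (akm2 akm1 ak sk : ℝ)
    (hakm2 : 0 < akm2) (hakm1 : 0 < akm1) (hak : 0 < ak) (hsk : 0 < sk)
    (hsks : sinf ≤ sk) (hbig : sinf / 2 ≤ akm1)
    (heq : ak = sk * Real.sqrt (akm1 / akm2))
    (hsmall : ρ₀ ^ (t - 1) * ak < sinf / 2) :
    sinf / 2 * ρ₀ ^ (2 * t) ≤ akm2 := by
  obtain ⟨n, rfl⟩ : ∃ n, t = n + 1 := ⟨t - 1, by omega⟩
  rw [Nat.add_sub_cancel] at hsmall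
  set r := Real.sqrt (akm1 / akm2) with hr
  have hr0 : 0 ≤ r := Real.sqrt_nonneg _
  have hr2 : r ^ 2 * akm2 = akm1 := by
    rw [hr, Real.sq_sqrt (by positivity), div_mul_cancel₀ _ hakm2.ne']
  have hq : 0 < ρ₀ ^ n := by positivity
  have hqr : ρ₀ ^ n * r < 1 / 2 := by
    have hle : ρ₀ ^ n * (sinf * r) ≤ ρ₀ ^ n * ak := by
      rw [heq]
      gcongr
    refine lt_of_mul_lt_mul_left ?_ hsinf.le
    linarith
  have hqr2 : (ρ₀ ^ n * r) ^ 2 ≤ (1 / 2) ^ 2 := by gcongr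
  have hρ₀sq : ρ₀ ^ 2 ≤ 2 ^ 2 := by gcongr
  calc sinf / 2 * ρ₀ ^ (2 * (n + 1)) = sinf / 2 * ((ρ₀ ^ n) ^ 2 * ρ₀ ^ 2) := by ring
    _ ≤ akm1 * ((ρ₀ ^ n) ^ 2 * 2 ^ 2) := by gcongr
    _ = 4 * ((ρ₀ ^ n * r) ^ 2 * akm2) := by rw [← hr2]; ring
    _ ≤ 4 * ((1 / 2) ^ 2 * akm2) := by gcongr
    _ = akm2 := by ring
end

section
/- Let s_∞ > 0, ρ₀ ∈ (1, 2), let t ≥ 2 be an integer, and let a_{k−2}, a_{k−1}, a_k, a_{k+1}, s_k, s_{k+1} be positive reals with s_k ≥ s_∞, s_{k+1} ≥ s_∞, a_k = s_k·√(a_{k−1}/a_{k−2}), a_{k+1} = s_{k+1}·√(a_k/a_{k−1}), a_k < s_∞/2, and ρ₀^{t−2}·a_{k+1} < s_∞/2. Then a_{k−2} = s_k²·s_{k+1}²/(a_k·a_{k+1}²), and consequently a_{k−2} ≥ (s_∞/2)·ρ₀^{2t}. -/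
theorem stmt12 (sinf ρ₀ : ℝ) (hsinf : 0 < sinf) (hρ₀1 : 1 < ρ₀) (hρ₀2 : ρ₀ < 2)
    (t : ℕ) (ht : 2 ≤ t)
    (akm2 akm1 ak akp1 sk skp1 : ℝ)
    (hakm2 : 0 < akm2) (hakm1 : 0 < akm1) (hak : 0 < ak) (hakp1 : 0 < akp1)
    (hsk : 0 < sk) (hskp1 : 0 < skp1)
    (hsks : sinf ≤ sk) (hskp1s : sinf ≤ skp1)
    (heqk : ak = sk * Real.sqrt (akm1 / akm2))
    (heqkp1 : akp1 = skp1 * Real.sqrt (ak / akm1))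
    (haksmall : ak < sinf / 2)
    (hsmall : ρ₀ ^ (t - 2) * akp1 < sinf / 2) :
    akm2 = sk ^ 2 * skp1 ^ 2 / (ak * akp1 ^ 2) ∧
      sinf / 2 * ρ₀ ^ (2 * t) ≤ akm2 := by
  have hk : ak ^ 2 = sk ^ 2 * (akm1 / akm2) := by
    rw [heqk, mul_pow, Real.sq_sqrt (by positivity)]
  have hkp1 : akp1 ^ 2 = skp1 ^ 2 * (ak / akm1) := by
    rw [heqkp1, mul_pow, Real.sq_sqrt (by positivity)]
  have heq : akm2 = sk ^ 2 * skp1 ^ 2 / (ak * akp1 ^ 2) := by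
    rw [eq_div_iff (by positivity), hkp1]
    field_simp at hk ⊢
    linear_combination hk
  refine ⟨heq, ?_⟩
  rw [heq, le_div_iff₀ (by positivity)]
  have hρ4 : ρ₀ ^ 4 ≤ 2 ^ 4 := by gcongr
  have hpow : ρ₀ ^ (2 * t) = ρ₀ ^ 4 * (ρ₀ ^ (t - 2)) ^ 2 := by
    rw [← pow_mul, ← pow_add]
    congr 1
    omega
  calc sinf / 2 * ρ₀ ^ (2 * t) * (ak * akp1 ^ 2)
      = sinf / 2 * ρ₀ ^ 4 * ak * (ρ₀ ^ (t - 2) * akp1) ^ 2 := by rw [hpow]; ring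
    _ ≤ sinf / 2 * 2 ^ 4 * (sinf / 2) * (sinf / 2) ^ 2 := by gcongr
    _ = sinf ^ 2 * sinf ^ 2 := by ring
    _ ≤ sk ^ 2 * skp1 ^ 2 := by gcongr
end
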